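/- arXiv:2412.09430 — 9 statements merged into one kernel-verified Lean document; each statement's English description precedes it below -/
import Mathlib

section
/- Let Ω be a finite nonempty set and L a negative definite kernel on Ω. Then for every probability vector p on Ω and every outcome y ∈ Ω, the kernel score satisfies S_L(p, y) ≥ 0. Moreover, if p = δ_y is the point mass at y (i.e., p(y) = 1 and p(x) = 0 for x ≠ y), then S_L(p, y) = 0. -/
open Finset

/-- For a negative definite kernel `L` on a finite nonempty set `Ω`,
the kernel score `S_L(p, y)` is nonnegative for every probability vector `p`
and outcome `y`, and equals zero when `p` is the point mass at `y`. -/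
theorem kernel_score_nonneg_and_zero_at_point_mass
    {Ω : Type*} [Fintype Ω] [Nonempty Ω] [DecidableEq Ω]
    (L : Ω → Ω → ℝ)
    (hL_nonneg : ∀ x x', 0 ≤ L x x')
    (hL_symm : ∀ x x', L x x' = L x' x)
    (hL_diag : ∀ x, L x x = 0)
    (hL_negdef : ∀ c : Ω → ℝ, (∑ x, c x) = 0 →
      (∑ x, ∑ x', c x * c x' * L x x') ≤ 0)
    (p : Ω → ℝ) (hp_nonneg : ∀ x, 0 ≤ p x) (hp_sum : (∑ x, p x) = 1)
    (y : Ω) :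
    0 ≤ (∑ x, p x * L x y) - (1 / 2) * ∑ x, ∑ x', p x * p x' * L x x' ∧
    (p = (fun x => if x = y then (1 : ℝ) else 0) →
      (∑ x, p x * L x y) - (1 / 2) * ∑ x, ∑ x', p x * p x' * L x x' = 0) := by
  refine ⟨?_, ?_⟩
  · have hneg := hL_negdef (fun x => p x - if x = y then 1 else 0) (by simp [hp_sum])
    have hexpand : ∑ x, ∑ x', (p x - if x = y then 1 else 0) *
        (p x' - if x' = y then 1 else 0) * L x x' =
        ∑ x, ∑ x', p x * p x' * L x x' - ∑ x, p x * L y x - ∑ x, p x * L x y := by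
      simp [sub_mul, mul_sub, Finset.sum_sub_distrib, hL_diag]
    have hswap : ∑ x, p x * L y x = ∑ x, p x * L x y :=
      Finset.sum_congr rfl fun x _ => by rw [hL_symm]
    linarith
  · rintro rfl
    simp [hL_diag]
end

section
/- Let Ω be a finite nonempty set and L a negative definite kernel on Ω. Then for all probability vectors h and p on Ω, the score divergence satisfies d_{S_L}(h, p) = −(1/2) Σ_{x∈Ω} Σ_{x̃∈Ω} (p(x) − h(x)) (p(x̃) − h(x̃)) L(x, x̃), and consequently d_{S_L}(h, p) ≥ 0; that is, the kernel score S_L is a proper scoring rule: Σ_{y∈Ω} p(y) S_L(h, y) ≥ Σ_{y∈Ω} p(y) S_L(p, y). -/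
open Finset

/-- The kernel score of a probability vector `p` at outcome `y`, for a kernel `L`
on a finite set `Ω`. -/
noncomputable def kernelScore {Ω : Type*} [Fintype Ω] (L : Ω → Ω → ℝ)
    (p : Ω → ℝ) (y : Ω) : ℝ :=
  (∑ x, p x * L x y) - (1 / 2) * ∑ x, ∑ x', p x * p x' * L x x'

/-- The score divergence `d_{S_L}(h, p)` between probability vectors `h` and `p`. -/
noncomputable def scoreDivergence {Ω : Type*} [Fintype Ω] (L : Ω → Ω → ℝ)
    (h p : Ω → ℝ) : ℝ :=
  (∑ y, p y * kernelScore L h y) - ∑ y, p y * kernelScore L p y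

/-- The expected kernel score of `q` under a probability vector `p`. -/
theorem sum_mul_kernelScore {Ω : Type*} [Fintype Ω] (L : Ω → Ω → ℝ) (q p : Ω → ℝ)
    (hp_sum : (∑ x, p x) = 1) :
    (∑ y, p y * kernelScore L q y)
      = (∑ x, ∑ x', q x * p x' * L x x') - (1 / 2) * ∑ x, ∑ x', q x * q x' * L x x' := by
  simp only [kernelScore, mul_sub, sum_sub_distrib]
  rw [← sum_mul, hp_sum, one_mul, sum_comm (f := fun x x' => q x * p x' * L x x')]
  congr 1
  refine sum_congr rfl fun y _ => ?_
  rw [mul_sum]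
  exact sum_congr rfl fun x _ => by ring

/-- Expansion of the quadratic form of a symmetric kernel at a difference. -/
theorem sum_sum_sub_mul_sub_mul {Ω : Type*} [Fintype Ω] (L : Ω → Ω → ℝ)
    (hL_symm : ∀ x x', L x x' = L x' x) (h p : Ω → ℝ) :
    (∑ x, ∑ x', (p x - h x) * (p x' - h x') * L x x')
      = (∑ x, ∑ x', p x * p x' * L x x') - 2 * (∑ x, ∑ x', h x * p x' * L x x')
        + ∑ x, ∑ x', h x * h x' * L x x' := by
  have hswap : (∑ x, ∑ x', p x * h x' * L x x') = ∑ x, ∑ x', h x * p x' * L x x' := by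
    rw [sum_comm]
    refine sum_congr rfl fun x _ => sum_congr rfl fun x' _ => ?_
    rw [hL_symm x' x]
    ring
  simp only [sub_mul, mul_sub, sum_sub_distrib]
  rw [hswap]
  ring

/-- For a negative definite kernel `L` on a finite nonempty set `Ω`,
the score divergence equals `-(1/2) ∑∑ (p x - h x)(p x' - h x') L x x'`,
hence is nonnegative; in particular the kernel score is a proper scoring rule. -/
theorem score_divergence_eq_and_nonneg
    {Ω : Type*} [Fintype Ω] [Nonempty Ω]
    (L : Ω → Ω → ℝ)
    (hL_nonneg : ∀ x x', 0 ≤ L x x')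
    (hL_symm : ∀ x x', L x x' = L x' x)
    (hL_diag : ∀ x, L x x = 0)
    (hL_negdef : ∀ c : Ω → ℝ, (∑ x, c x) = 0 →
      (∑ x, ∑ x', c x * c x' * L x x') ≤ 0)
    (h p : Ω → ℝ)
    (hh_nonneg : ∀ x, 0 ≤ h x) (hh_sum : (∑ x, h x) = 1)
    (hp_nonneg : ∀ x, 0 ≤ p x) (hp_sum : (∑ x, p x) = 1) :
    scoreDivergence L h p
      = -(1 / 2) * ∑ x, ∑ x', (p x - h x) * (p x' - h x') * L x x' ∧
    0 ≤ scoreDivergence L h p ∧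
    (∑ y, p y * kernelScore L h y) ≥ ∑ y, p y * kernelScore L p y := by
  have heq : scoreDivergence L h p
      = -(1 / 2) * ∑ x, ∑ x', (p x - h x) * (p x' - h x') * L x x' := by
    rw [scoreDivergence, sum_mul_kernelScore L h p hp_sum, sum_mul_kernelScore L p p hp_sum,
      sum_sum_sub_mul_sub_mul L hL_symm]
    ring
  have hnonneg : 0 ≤ scoreDivergence L h p := by
    have hquad := hL_negdef (fun x => p x - h x) (by rw [sum_sub_distrib, hp_sum, hh_sum, sub_self])
    rw [heq]
    linarith
  exact ⟨heq, hnonneg, sub_nonneg.mp hnonneg⟩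
end

section
/- Let Ω be a finite nonempty set, S a scoring rule on Ω, and p¹, …, pⁿ probability vectors on Ω with nonnegative weights ω_1, …, ω_n summing to one; let p^ω = Σ_{i=1}^n ω_i pⁱ be the linear pool. Then the entropy of the linear pool decomposes as Σ_{y∈Ω} p^ω(y) S(p^ω, y) = Σ_{i=1}^n ω_i d_S(p^ω, pⁱ) + Σ_{i=1}^n ω_i Σ_{y∈Ω} pⁱ(y) S(pⁱ, y). Moreover, if S is proper, then the average divergence term D = Σ_{i=1}^n ω_i d_S(p^ω, pⁱ) is nonnegative. -/
open Finset

/-- Entropy decomposition of the linear pool for a general scoring rule: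
the pool's entropy equals average divergence (disagreement) plus average entropy of
the components; moreover, if the scoring rule is proper then the average divergence
term is nonnegative. Here `S h y` is the score of probability vector `h` at outcome
`y`, and the divergence is `d_S(h, q) = ∑ y, q y * S h y - ∑ y, q y * S q y`. -/
theorem linear_pool_entropy_decomposition
    {Ω : Type*} [Fintype Ω] [Nonempty Ω] {n : ℕ}
    (S : (Ω → ℝ) → Ω → ℝ)
    (p : Fin n → Ω → ℝ)
    (hp_nonneg : ∀ i x, 0 ≤ p i x) (hp_sum : ∀ i, (∑ x, p i x) = 1)
    (ω : Fin n → ℝ) (hω_nonneg : ∀ i, 0 ≤ ω i) (hω_sum : (∑ i, ω i) = 1)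
    (pω : Ω → ℝ) (hpω : pω = fun x => ∑ i, ω i * p i x) :
    (∑ y, pω y * S pω y)
      = (∑ i, ω i * ((∑ y, p i y * S pω y) - ∑ y, p i y * S (p i) y))
        + ∑ i, ω i * ∑ y, p i y * S (p i) y ∧
    ((∀ h q : Ω → ℝ, (∀ x, 0 ≤ h x) → (∑ x, h x) = 1 →
        (∀ x, 0 ≤ q x) → (∑ x, q x) = 1 →
        0 ≤ (∑ y, q y * S h y) - ∑ y, q y * S q y) →
      0 ≤ ∑ i, ω i * ((∑ y, p i y * S pω y) - ∑ y, p i y * S (p i) y)) := by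
  have hpω_apply : ∀ x, pω x = ∑ i, ω i * p i x := fun x => congrFun hpω x
  constructor
  · have expected_score : ∀ f : Ω → ℝ,
        ∑ y, pω y * f y = ∑ i, ω i * ∑ y, p i y * f y := by
      intro f
      simp_rw [hpω_apply, Finset.sum_mul, Finset.mul_sum, mul_assoc]
      exact Finset.sum_comm
    rw [expected_score, ← Finset.sum_add_distrib]
    exact Finset.sum_congr rfl fun i _ => by ring
  · intro hproper
    have hpω_nonneg : ∀ x, 0 ≤ pω x := fun x => by
      rw [hpω_apply]
      exact Finset.sum_nonneg fun i _ => mul_nonneg (hω_nonneg i) (hp_nonneg i x)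
    have hpω_sum : ∑ x, pω x = 1 := by
      simp_rw [hpω_apply]
      rw [Finset.sum_comm]
      simp_rw [← Finset.mul_sum, hp_sum, mul_one, hω_sum]
    exact Finset.sum_nonneg fun i _ => mul_nonneg (hω_nonneg i)
      (hproper pω (p i) hpω_nonneg hpω_sum (hp_nonneg i) (hp_sum i))
end

section
/- Let Ω be a finite nonempty set and L a negative definite kernel on Ω. Let p¹, …, pⁿ be probability vectors on Ω with nonnegative weights ω_1, …, ω_n summing to one, let p^ω = Σ_{i=1}^n ω_i pⁱ be the linear pool, and let D = (1/2) Σ_{x,x̃∈Ω} p^ω(x) p^ω(x̃) L(x, x̃) − (1/2) Σ_{i=1}^n ω_i Σ_{x,x̃∈Ω} pⁱ(x) pⁱ(x̃) L(x, x̃) denote the disagreement. Then for every outcome y ∈ Ω, the kernel score of the linear pool satisfies S_L(p^ω, y) = Σ_{i=1}^n ω_i S_L(pⁱ, y) − D, where D ≥ 0; in particular, S_L(p^ω, y) ≤ Σ_{i=1}^n ω_i S_L(pⁱ, y), and the improvement of the pool over the average component score is independent of y. -/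
open Finset

/-- Integration against a linear pool is the weighted average of the component integrals. -/
lemma sum_pool_mul {ι Ω : Type*} [Fintype ι] [Fintype Ω] (w : ι → ℝ) (p : ι → Ω → ℝ)
    (f : Ω → ℝ) :
    ∑ x, (∑ i, w i * p i x) * f x = ∑ i, w i * ∑ x, p i x * f x := by
  simp only [Finset.sum_mul, Finset.mul_sum]
  rw [Finset.sum_comm]
  simp only [mul_assoc]

/-- Expansion of the quadratic form of a symmetric kernel at a difference. -/
lemma sum_sub_mul_sub_mul_kernel {Ω : Type*} [Fintype Ω] (L : Ω → Ω → ℝ)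
    (hL : ∀ x x', L x x' = L x' x) (p q : Ω → ℝ) :
    ∑ x, ∑ x', (p x - q x) * (p x' - q x') * L x x' =
      (∑ x, ∑ x', p x * p x' * L x x') + (∑ x, ∑ x', q x * q x' * L x x')
        - 2 * ∑ x, p x * ∑ x', q x' * L x x' := by
  have hswap : ∑ x, ∑ x', q x * p x' * L x x' = ∑ x, ∑ x', p x * q x' * L x x' := by
    rw [Finset.sum_comm]
    refine Finset.sum_congr rfl fun x _ => Finset.sum_congr rfl fun x' _ => ?_
    rw [hL x' x]
    ring
  simp only [sub_mul, mul_sub, Finset.sum_sub_distrib, hswap, Finset.mul_sum, ← mul_assoc]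
  simp only [mul_assoc, ← Finset.mul_sum]
  ring

/-- For a negative definite kernel `L`, the kernel score of the linear
pool at any outcome `y` equals the weighted average of the component scores minus
the disagreement `D`, where `D ≥ 0` does not depend on `y`; in particular the pool's
score never exceeds the average component score. -/
theorem linear_pool_score_decomposition
    {Ω : Type*} [Fintype Ω] [Nonempty Ω] {n : ℕ}
    (L : Ω → Ω → ℝ)
    (hL_nonneg : ∀ x x', 0 ≤ L x x')
    (hL_symm : ∀ x x', L x x' = L x' x)
    (hL_diag : ∀ x, L x x = 0)
    (hL_negdef : ∀ c : Ω → ℝ, (∑ x, c x) = 0 →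
      (∑ x, ∑ x', c x * c x' * L x x') ≤ 0)
    (p : Fin n → Ω → ℝ)
    (hp_nonneg : ∀ i x, 0 ≤ p i x) (hp_sum : ∀ i, (∑ x, p i x) = 1)
    (ω : Fin n → ℝ) (hω_nonneg : ∀ i, 0 ≤ ω i) (hω_sum : (∑ i, ω i) = 1)
    (pω : Ω → ℝ) (hpω : pω = fun x => ∑ i, ω i * p i x)
    (D : ℝ)
    (hD : D = (1 / 2) * (∑ x, ∑ x', pω x * pω x' * L x x')
        - (1 / 2) * ∑ i, ω i * ∑ x, ∑ x', p i x * p i x' * L x x') :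
    (∀ y : Ω, kernelScore L pω y = (∑ i, ω i * kernelScore L (p i) y) - D) ∧
    0 ≤ D ∧
    (∀ y : Ω, kernelScore L pω y ≤ ∑ i, ω i * kernelScore L (p i) y) := by
  have hscore : ∀ y : Ω, kernelScore L pω y = (∑ i, ω i * kernelScore L (p i) y) - D := by
    intro y
    have hlin : ∑ x, pω x * L x y = ∑ i, ω i * ∑ x, p i x * L x y := by
      rw [hpω]
      exact sum_pool_mul ω p fun x => L x y
    have havg : ∑ i, ω i * kernelScore L (p i) y = (∑ i, ω i * ∑ x, p i x * L x y)
        - (1 / 2) * ∑ i, ω i * ∑ x, ∑ x', p i x * p i x' * L x x' := by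
      simp only [kernelScore, mul_sub, Finset.sum_sub_distrib, mul_left_comm _ (1 / 2 : ℝ),
        ← Finset.mul_sum]
    rw [havg, hD, kernelScore, hlin]
    ring
  have hpω_sum : ∑ x, pω x = 1 := by
    have h := sum_pool_mul ω p fun _ => 1
    simpa only [mul_one, hp_sum, hω_sum, hpω] using h
  have hcross : ∑ i, ω i * ∑ x, p i x * ∑ x', pω x' * L x x' =
      ∑ x, ∑ x', pω x * pω x' * L x x' := by
    rw [← sum_pool_mul ω p fun x => ∑ x', pω x' * L x x']
    simp only [mul_assoc, ← Finset.mul_sum, ← congrFun hpω _]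
  have hneg : ∑ i, ω i * ∑ x, ∑ x', (p i x - pω x) * (p i x' - pω x') * L x x' ≤ 0 := by
    refine Finset.sum_nonpos fun i _ => mul_nonpos_of_nonneg_of_nonpos (hω_nonneg i) ?_
    refine hL_negdef (fun x => p i x - pω x) ?_
    rw [Finset.sum_sub_distrib, hp_sum, hpω_sum, sub_self]
  have hD_nonneg : 0 ≤ D := by
    simp only [sum_sub_mul_sub_mul_kernel L hL_symm] at hneg
    simp only [mul_sub, mul_add, Finset.sum_sub_distrib,
      Finset.sum_add_distrib, mul_left_comm _ (2 : ℝ)] at hneg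
    rw [← Finset.sum_mul, hω_sum, ← Finset.mul_sum, hcross] at hneg
    linarith
  exact ⟨hscore, hD_nonneg, fun y => by linarith [hscore y]⟩
end

section
/- Let Ω be a finite nonempty set and L a negative definite kernel on Ω. Let p¹, …, pⁿ be probability vectors on Ω with nonnegative weights ω_1, …, ω_n summing to one, and let p^ω = Σ_{i=1}^n ω_i pⁱ be the linear pool. Then for every probability vector h on Ω, the generalized disagreement satisfies D_gen(h) − D_gen(p^ω) = −(1/2) Σ_{x∈Ω} Σ_{x̃∈Ω} (h(x) − p^ω(x)) (h(x̃) − p^ω(x̃)) L(x, x̃). -/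
open Finset

/-- The generalized disagreement of a probability vector `h` around components
`p i` with weights `ω i`, for a kernel `L` on a finite set `Ω`. -/
noncomputable def genDisagreement {Ω : Type*} [Fintype Ω] {n : ℕ}
    (L : Ω → Ω → ℝ) (ω : Fin n → ℝ) (p : Fin n → Ω → ℝ) (h : Ω → ℝ) : ℝ :=
  ∑ i, ω i * ((∑ x, ∑ x', p i x * h x' * L x x')
      - (1 / 2) * (∑ x, ∑ x', h x * h x' * L x x')
      - (1 / 2) * (∑ x, ∑ x', p i x * p i x' * L x x'))

/-- Up to a term not involving `h`, the components enter the generalized disagreement only through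
their linear pool. -/
theorem genDisagreement_eq_pool {Ω : Type*} [Fintype Ω] {n : ℕ}
    (L : Ω → Ω → ℝ) (ω : Fin n → ℝ) (hω_sum : ∑ i, ω i = 1) (p : Fin n → Ω → ℝ) (h : Ω → ℝ) :
    genDisagreement L ω p h =
      (∑ x, ∑ x', (∑ i, ω i * p i x) * h x' * L x x')
        - (1 / 2) * (∑ x, ∑ x', h x * h x' * L x x')
        - (1 / 2) * ∑ i, ω i * ∑ x, ∑ x', p i x * p i x' * L x x' := by
  have hpool : ∑ i, ω i * ∑ x, ∑ x', p i x * h x' * L x x' =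
      ∑ x, ∑ x', (∑ i, ω i * p i x) * h x' * L x x' := by
    simp only [mul_sum, sum_mul]
    rw [sum_comm]
    refine sum_congr rfl fun x _ => ?_
    rw [sum_comm]
    simp only [mul_assoc]
  simp only [genDisagreement, mul_sub, sum_sub_distrib, hpool, ← sum_mul, hω_sum, one_mul]
  rw [mul_sum univ (fun i => ω i * ∑ x, ∑ x', p i x * p i x' * L x x')]
  simp only [mul_left_comm]

/-- For a negative definite kernel `L`, the difference between the
generalized disagreement around an arbitrary probability vector `h` and the
generalized disagreement around the linear pool `pω` equals
`-(1/2) ∑∑ (h x - pω x)(h x' - pω x') L x x'`. -/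
theorem genDisagreement_difference_formula
    {Ω : Type*} [Fintype Ω] [Nonempty Ω] {n : ℕ}
    (L : Ω → Ω → ℝ)
    (hL_nonneg : ∀ x x', 0 ≤ L x x')
    (hL_symm : ∀ x x', L x x' = L x' x)
    (hL_diag : ∀ x, L x x = 0)
    (hL_negdef : ∀ c : Ω → ℝ, (∑ x, c x) = 0 →
      (∑ x, ∑ x', c x * c x' * L x x') ≤ 0)
    (p : Fin n → Ω → ℝ)
    (hp_nonneg : ∀ i x, 0 ≤ p i x) (hp_sum : ∀ i, (∑ x, p i x) = 1)
    (ω : Fin n → ℝ) (hω_nonneg : ∀ i, 0 ≤ ω i) (hω_sum : (∑ i, ω i) = 1)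
    (pω : Ω → ℝ) (hpω : pω = fun x => ∑ i, ω i * p i x)
    (h : Ω → ℝ) (hh_nonneg : ∀ x, 0 ≤ h x) (hh_sum : (∑ x, h x) = 1) :
    genDisagreement L ω p h - genDisagreement L ω p pω
      = -(1 / 2) * ∑ x, ∑ x', (h x - pω x) * (h x' - pω x') * L x x' := by
  have hpx : ∀ x, ∑ i, ω i * p i x = pω x := fun x => by rw [hpω]
  have hcomm : ∑ x, ∑ x', h x * pω x' * L x x' = ∑ x, ∑ x', pω x * h x' * L x x' := by
    rw [sum_comm]
    refine sum_congr rfl fun x _ => sum_congr rfl fun x' _ => ?_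
    rw [hL_symm x' x, mul_comm (h x')]
  have hexpand : ∑ x, ∑ x', (h x - pω x) * (h x' - pω x') * L x x' =
      ∑ x, ∑ x', h x * h x' * L x x' - ∑ x, ∑ x', h x * pω x' * L x x'
        - ∑ x, ∑ x', pω x * h x' * L x x' + ∑ x, ∑ x', pω x * pω x' * L x x' := by
    simp only [← sum_sub_distrib, ← sum_add_distrib]
    refine sum_congr rfl fun x _ => sum_congr rfl fun x' _ => ?_
    ring
  rw [genDisagreement_eq_pool L ω hω_sum, genDisagreement_eq_pool L ω hω_sum, hexpand, hcomm]
  simp only [hpx]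
  ring
end

section
/- Let A be a symmetric real k × k matrix, and let F^1, …, F^n be Borel probability measures on ℝ^k, each with finite second moments (∫ ‖x‖² dF^i(x) < ∞). Let ω_1, …, ω_n be nonnegative weights summing to one, let F^ω = Σ_{i=1}^n ω_i F^i be the linear pool, and write μ_i = ∫ x dF^i(x) and μ^ω = ∫ x dF^ω(x) for the mean vectors. Then the disagreement under the kernel L_A(z, z̃) = (z̃ − z)ᵀ A (z̃ − z) satisfies (1/2) ∫∫ (x̃ − x)ᵀ A (x̃ − x) dF^ω(x) dF^ω(x̃) − (1/2) Σ_{i=1}^n ω_i ∫∫ (x̃ − x)ᵀ A (x̃ − x) dF^i(x) dF^i(x̃) = Σ_{i=1}^n ω_i (μ_i − μ^ω)ᵀ A (μ_i − μ^ω). -/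
open MeasureTheory Matrix

section BilinearForms

lemma integrable_id_of_integrable_norm_sq {E : Type*} [NormedAddCommGroup E] [MeasurableSpace E]
    [BorelSpace E] [SecondCountableTopology E] {P : Measure E} [IsFiniteMeasure P]
    (hP : Integrable (fun x => ‖x‖ ^ 2) P) : Integrable (fun x => x) P :=
  ((memLp_two_iff_integrable_sq_norm (by fun_prop)).2 hP).integrable one_le_two

variable {E : Type*} [NormedAddCommGroup E] [NormedSpace ℝ E]

lemma integrable_bilin_self [MeasurableSpace E] [BorelSpace E] (B : E →L[ℝ] E →L[ℝ] ℝ) {P : Measure E}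
    (hP : Integrable (fun x => ‖x‖ ^ 2) P) : Integrable (fun x => B x x) P := by
  refine (hP.const_mul ‖B‖).mono' ?_ (ae_of_all _ fun x => ?_)
  · have hc : Continuous fun x => B x x := by fun_prop
    exact hc.measurable.aestronglyMeasurable
  · simpa [pow_two, mul_assoc] using B.le_opNorm₂ x x

/-- For two independent draws from `P`, the expected quadratic form of the difference is twice
the expected quadratic form minus twice the quadratic form of the mean. -/
lemma integral_integral_bilin_sub [MeasurableSpace E] [BorelSpace E] [SecondCountableTopology E]
    [CompleteSpace E] (B : E →L[ℝ] E →L[ℝ] ℝ) {P : Measure E} [IsProbabilityMeasure P] (hP : Integrable (fun x => ‖x‖ ^ 2) P) :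
    ∫ x, ∫ y, B (y - x) (y - x) ∂P ∂P
      = 2 * ∫ x, B x x ∂P - 2 * B (∫ x, x ∂P) (∫ x, x ∂P) := by
  have hid := integrable_id_of_integrable_norm_sq hP
  have hq := integrable_bilin_self B hP
  set m := ∫ x, x ∂P with hm
  have hint (c : ℝ) (L : E →L[ℝ] ℝ) :
      ∫ x, (B x x + (c - L x)) ∂P = (∫ x, B x x ∂P) + (c - L m) := by
    have hL : Integrable (fun x => L x) P := L.integrable_comp hid
    have hcL : Integrable (fun x => c - L x) P := (integrable_const c).sub hL
    rw [integral_add hq hcL, integral_sub (integrable_const c) hL,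
      L.integral_comp_comm hid]
    simp [hm]
  have hinner (x : E) :
      ∫ y, B (y - x) (y - x) ∂P = B x x + ((∫ y, B y y ∂P) - (B.flip m + B m) x) := by
    have hexp (y : E) : B (y - x) (y - x) = B y y + (B x x - (B.flip x + B x) y) := by
      simp only [map_sub, _root_.sub_apply, _root_.add_apply, ContinuousLinearMap.flip_apply]
      ring
    simp_rw [hexp, hint]
    simp only [_root_.add_apply, ContinuousLinearMap.flip_apply]
    ring
  simp_rw [hinner, hint]
  simp only [_root_.add_apply, ContinuousLinearMap.flip_apply]
  ring

lemma sum_mul_bilin_sub_sum_smul {ι : Type*} [Fintype ι] (B : E →L[ℝ] E →L[ℝ] ℝ) (ω : ι → ℝ)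
    (hω : ∑ i, ω i = 1) (v : ι → E) {m : E} (hm : m = ∑ i, ω i • v i) :
    ∑ i, ω i * B (v i - m) (v i - m) = ∑ i, ω i * B (v i) (v i) - B m m := by
  have hexp (i : ι) : ω i * B (v i - m) (v i - m)
      = ω i * B (v i) (v i) - (B.flip m + B m) (ω i • v i) + ω i * B m m := by
    simp only [map_sub, map_smul, _root_.sub_apply, _root_.add_apply,
      ContinuousLinearMap.flip_apply, smul_eq_mul]
    ring
  simp_rw [hexp, Finset.sum_add_distrib, Finset.sum_sub_distrib, ← map_sum, ← hm,
    ← Finset.sum_mul, hω]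
  simp only [_root_.add_apply, ContinuousLinearMap.flip_apply]
  ring

end BilinearForms

lemma integral_sum_ofReal_smul_measure {ι α G : Type*} [Fintype ι] [MeasurableSpace α]
    [NormedAddCommGroup G] [NormedSpace ℝ G] {F : ι → Measure α} {ω : ι → ℝ}
    (hω : ∀ i, 0 ≤ ω i) {f : α → G} (hf : ∀ i, Integrable f (F i)) :
    ∫ x, f x ∂(∑ i, ENNReal.ofReal (ω i) • F i) = ∑ i, ω i • ∫ x, f x ∂(F i) := by
  rw [integral_finsetSum_measure fun i _ => (hf i).smul_measure ENNReal.ofReal_ne_top]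
  simp [integral_smul_measure, hω]

/-- For a symmetric real `k × k` matrix `A` and probability measures
`F 1, …, F n` on `ℝ^k` with finite second moments, the disagreement of the linear
pool under the kernel `L_A(z, z̃) = (z̃ - z)ᵀ A (z̃ - z)` equals the weighted sum of
the quadratic forms `(μ i - μ^ω)ᵀ A (μ i - μ^ω)` of the deviations of the component
mean vectors from the pool's mean vector. -/
theorem multivariate_squared_error_disagreement
    {k : ℕ} (A : Matrix (Fin k) (Fin k) ℝ) (hA_symm : A.IsSymm)
    {n : ℕ} (F : Fin n → Measure (Fin k → ℝ))
    (hprob : ∀ i, IsProbabilityMeasure (F i))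
    (hmom : ∀ i, Integrable (fun x => ‖x‖ ^ 2) (F i))
    (ω : Fin n → ℝ) (hω_nonneg : ∀ i, 0 ≤ ω i) (hω_sum : (∑ i, ω i) = 1)
    (Fω : Measure (Fin k → ℝ)) (hFω : Fω = ∑ i, ENNReal.ofReal (ω i) • F i)
    (μ : Fin n → (Fin k → ℝ)) (hμ : ∀ i, μ i = ∫ x, x ∂(F i))
    (μω : Fin k → ℝ) (hμω : μω = ∫ x, x ∂Fω) :
    (1 / 2) * (∫ x, (∫ x', ((x' - x) ⬝ᵥ (A *ᵥ (x' - x))) ∂Fω) ∂Fω)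
        - (1 / 2) * ∑ i, ω i *
            ∫ x, (∫ x', ((x' - x) ⬝ᵥ (A *ᵥ (x' - x))) ∂(F i)) ∂(F i)
      = ∑ i, ω i * ((μ i - μω) ⬝ᵥ (A *ᵥ (μ i - μω))) := by
  have hid (i : Fin n) := integrable_id_of_integrable_norm_sq (hmom i)
  have hprobω : IsProbabilityMeasure Fω := by
    constructor
    simp [hFω, ← ENNReal.ofReal_sum_of_nonneg fun i _ => hω_nonneg i, hω_sum]
  have hmomω : Integrable (fun x => ‖x‖ ^ 2) Fω := by
    rw [hFω, integrable_finsetSum_measure]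
    exact fun i _ => (hmom i).smul_measure ENNReal.ofReal_ne_top
  let B : (Fin k → ℝ) →L[ℝ] (Fin k → ℝ) →L[ℝ] ℝ :=
    LinearMap.toContinuousBilinearMap (Matrix.toLinearMap₂' ℝ A)
  have hB (x y : Fin k → ℝ) : x ⬝ᵥ (A *ᵥ y) = B x y :=
    (Matrix.toLinearMap₂'_apply' A x y).symm
  have hmean : μω = ∑ i, ω i • μ i := by
    rw [hμω, hFω, integral_sum_ofReal_smul_measure hω_nonneg hid]
    simp_rw [hμ]
  have hquad : ∫ x, B x x ∂Fω = ∑ i, ω i * ∫ x, B x x ∂(F i) := by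
    rw [hFω]
    exact integral_sum_ofReal_smul_measure hω_nonneg fun i => integrable_bilin_self B (hmom i)
  simp_rw [hB]
  rw [sum_mul_bilin_sub_sum_smul B ω hω_sum μ hmean, integral_integral_bilin_sub B hmomω, ← hμω,
    hquad]
  simp_rw [fun i => integral_integral_bilin_sub B (hmom i), ← hμ, mul_sub, Finset.sum_sub_distrib,
    mul_left_comm _ (2 : ℝ), ← Finset.mul_sum]
  ring
end

section
/- Let F^1, …, F^n : ℝ → ℝ be the cumulative distribution functions of Borel probability measures μ_1, …, μ_n on ℝ, each with finite first moment (∫ |x| dμ_i(x) < ∞), let ω_1, …, ω_n be nonnegative weights summing to one, and let F^ω(z) = Σ_{i=1}^n ω_i F^i(z) be the CDF of the linear pool. Then the CRPS disagreement equals the weighted average Cramér distance between the components and the pool: ∫_{−∞}^{∞} F^ω(z)(1 − F^ω(z)) dz − Σ_{i=1}^n ω_i ∫_{−∞}^{∞} F^i(z)(1 − F^i(z)) dz = Σ_{i=1}^n ω_i ∫_{−∞}^{∞} (F^i(z) − F^ω(z))² dz. -/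
open MeasureTheory

/-- The tails of a finite measure with finite first moment are integrable. -/
lemma integrableOn_measureReal_le_abs (μ : Measure ℝ) [IsFiniteMeasure μ]
    (hμ : Integrable (fun x => |x|) μ) :
    IntegrableOn (fun t => μ.real {x | t ≤ |x|}) (Set.Ioi 0) := by
  have hanti : Antitone fun t : ℝ => μ.real {x | t ≤ |x|} := fun s t hst =>
    measureReal_mono fun x (hx : t ≤ |x|) => hst.trans hx
  refine ⟨hanti.measurable.aestronglyMeasurable, ?_⟩
  rw [hasFiniteIntegral_iff_ofReal (Filter.Eventually.of_forall fun _ => measureReal_nonneg)]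
  simp only [measureReal_def, ENNReal.ofReal_toReal (measure_ne_top μ _)]
  rw [← lintegral_eq_lintegral_meas_le μ (Filter.Eventually.of_forall fun x => abs_nonneg x)
    hμ.aemeasurable]
  exact (hasFiniteIntegral_iff_ofReal
    (Filter.Eventually.of_forall fun x => abs_nonneg x)).1 hμ.hasFiniteIntegral

/-- An even function on `ℝ` is integrable if it is integrable on the positive half-line. -/
lemma integrable_comp_abs_of_integrableOn_Ioi {E : Type*} [NormedAddCommGroup E] {f : ℝ → E}
    (hf : IntegrableOn f (Set.Ioi 0)) : Integrable fun x => f |x| := by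
  have hpos : IntegrableOn (fun x => f |x|) (Set.Ioi 0) :=
    hf.congr_fun (fun x hx => by rw [abs_of_pos hx]) measurableSet_Ioi
  have hneg : IntegrableOn (fun x => f |x|) (Set.Iic 0) := by
    have hemb : MeasurableEmbedding (Neg.neg : ℝ → ℝ) := (Homeomorph.neg ℝ).measurableEmbedding
    rw [← Measure.map_neg_eq_self (volume : Measure ℝ), hemb.integrableOn_map_iff]
    simpa [Function.comp_def] using Iff.mpr integrableOn_Ici_iff_integrableOn_Ioi hpos
  rw [← integrableOn_univ, ← Set.Iic_union_Ioi (a := (0 : ℝ))]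
  exact hneg.union hpos

/-- The CDF of a probability measure with finite first moment differs from the CDF of the Dirac
mass at `0` by an integrable function. -/
lemma integrable_measureReal_Iic_sub_indicator (μ : Measure ℝ) [IsProbabilityMeasure μ]
    (hμ : Integrable (fun x => |x|) μ) :
    Integrable fun z => μ.real (Set.Iic z) - (Set.Ici (0 : ℝ)).indicator 1 z := by
  have hmono : Monotone fun z : ℝ => μ.real (Set.Iic z) := fun _ _ h =>
    measureReal_mono (Set.Iic_subset_Iic.2 h)
  refine (integrable_comp_abs_of_integrableOn_Ioi (integrableOn_measureReal_le_abs μ hμ)).mono'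
    (hmono.measurable.sub
      (measurable_one.indicator measurableSet_Ici)).aestronglyMeasurable
    (Filter.Eventually.of_forall fun z => ?_)
  rcases le_or_gt 0 z with hz | hz
  · have hcompl : μ.real (Set.Iic z) - 1 = -μ.real (Set.Ioi z) := by
      rw [← Set.compl_Iic, probReal_compl_eq_one_sub measurableSet_Iic]
      ring
    rw [Set.indicator_of_mem (Set.mem_Ici.2 hz), Pi.one_apply, hcompl, norm_neg,
      Real.norm_of_nonneg measureReal_nonneg]
    refine measureReal_mono fun x (hx : z < x) => ?_
    rw [Set.mem_ofPred_eq, abs_of_nonneg hz]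
    exact hx.le.trans (le_abs_self x)
  · rw [Set.indicator_of_notMem (by simpa using hz), sub_zero,
      Real.norm_of_nonneg measureReal_nonneg]
    refine measureReal_mono fun x (hx : x ≤ z) => ?_
    rw [Set.mem_ofPred_eq, abs_of_neg hz]
    exact (neg_le_neg hx).trans (neg_le_abs x)

/-- The weighted variance identity behind the decomposition of the entropy of a mixture. -/
lemma sum_mul_sub_sq_eq {ι : Type*} [Fintype ι] (w a : ι → ℝ) (hw : ∑ i, w i = 1) :
    ∑ i, w i * (a i - ∑ j, w j * a j) ^ 2 =
      (∑ j, w j * a j) * (1 - ∑ j, w j * a j) - ∑ i, w i * (a i * (1 - a i)) := by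
  set m := ∑ j, w j * a j with hm
  have hterm : ∀ i, w i * (a i - m) ^ 2 =
      (1 - 2 * m) * (w i * a i) - w i * (a i * (1 - a i)) + m ^ 2 * w i := fun i => by ring
  simp_rw [hterm, Finset.sum_add_distrib, Finset.sum_sub_distrib, ← Finset.mul_sum]
  rw [← hm, hw]
  ring

/-- For probability measures `μ 1, …, μ n` on ℝ with finite first
moments, with CDFs `F i` and linear pool CDF `Fω = ∑ i, ω i * F i`, the CRPS
disagreement (pool entropy minus average component entropy) equals the weighted
average Cramér distance between the components and the pool. -/
theorem crps_disagreement_eq_cramer_distance {n : ℕ}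
    (μ : Fin n → Measure ℝ)
    (hprob : ∀ i, IsProbabilityMeasure (μ i))
    (hmom : ∀ i, Integrable (fun x => |x|) (μ i))
    (ω : Fin n → ℝ) (hω_nonneg : ∀ i, 0 ≤ ω i) (hω_sum : (∑ i, ω i) = 1)
    (F : Fin n → ℝ → ℝ) (hF : ∀ i z, F i z = ((μ i) (Set.Iic z)).toReal)
    (Fω : ℝ → ℝ) (hFω : Fω = fun z => ∑ i, ω i * F i z) :
    (∫ z, Fω z * (1 - Fω z)) - (∑ i, ω i * ∫ z, F i z * (1 - F i z))
      = ∑ i, ω i * ∫ z, (F i z - Fω z) ^ 2 := by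
  have hFreal : ∀ i, F i = fun z => (μ i).real (Set.Iic z) := fun i => funext (hF i)
  have hF_nonneg : ∀ i z, 0 ≤ F i z := fun i z => by
    rw [hFreal]; exact measureReal_nonneg
  have hF_le_one : ∀ i z, F i z ≤ 1 := fun i z => by
    have := hprob i
    rw [hFreal]; exact measureReal_le_one
  have hF_sub : ∀ i, Integrable fun z => F i z - (Set.Ici (0 : ℝ)).indicator 1 z := fun i => by
    have := hprob i
    rw [hFreal]; exact integrable_measureReal_Iic_sub_indicator (μ i) (hmom i)
  have hF_meas : ∀ i, Measurable (F i) := fun i => by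
    have := hprob i
    have hmono : Monotone (F i) := by
      rw [hFreal]; exact fun _ _ h => measureReal_mono (Set.Iic_subset_Iic.2 h)
    exact hmono.measurable
  have hF_entropy : ∀ i, Integrable fun z => F i z * (1 - F i z) := fun i => by
    refine (hF_sub i).mono ((hF_meas i).mul
      (measurable_const.sub (hF_meas i))).aestronglyMeasurable
      (Filter.Eventually.of_forall fun z => ?_)
    have h0 := hF_nonneg i z
    have h1 := hF_le_one i z
    rw [Real.norm_of_nonneg (mul_nonneg h0 (sub_nonneg.2 h1)), Real.norm_eq_abs]
    by_cases hz : z ∈ Set.Ici (0 : ℝ)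
    · rw [Set.indicator_of_mem hz, Pi.one_apply]
      nlinarith [neg_le_abs (F i z - 1)]
    · rw [Set.indicator_of_notMem hz, sub_zero]
      nlinarith [le_abs_self (F i z)]
  have hFω_nonneg : ∀ z, 0 ≤ Fω z := fun z => by
    rw [hFω]
    exact Finset.sum_nonneg fun i _ => mul_nonneg (hω_nonneg i) (hF_nonneg i z)
  have hFω_le_one : ∀ z, Fω z ≤ 1 := fun z => by
    rw [hFω, ← hω_sum]
    exact Finset.sum_le_sum fun i _ => mul_le_of_le_one_right (hω_nonneg i) (hF_le_one i z)
  have hFω_sub : Integrable fun z => Fω z - (Set.Ici (0 : ℝ)).indicator 1 z := by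
    refine (integrable_finsetSum Finset.univ fun i _ => (hF_sub i).const_mul (ω i)).congr
      (Filter.Eventually.of_forall fun z => ?_)
    simp only [hFω, mul_sub, Finset.sum_sub_distrib, ← Finset.sum_mul, hω_sum, one_mul]
  have hcramer : ∀ i, Integrable fun z => (F i z - Fω z) ^ 2 := fun i => by
    have hdiff : Integrable fun z => F i z - Fω z := by
      simpa [Pi.sub_def] using (hF_sub i).sub hFω_sub
    refine hdiff.mono (hdiff.aestronglyMeasurable.pow 2)
      (Filter.Eventually.of_forall fun z => ?_)
    have habs : |F i z - Fω z| ≤ 1 := abs_sub_le_of_nonneg_of_le (hF_nonneg i z)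
      (hF_le_one i z) (hFω_nonneg z) (hFω_le_one z)
    rw [norm_pow, Real.norm_eq_abs]
    exact pow_le_of_le_one (abs_nonneg _) habs two_ne_zero
  have hpointwise : ∀ z, Fω z * (1 - Fω z) =
      ∑ i, ω i * (F i z - Fω z) ^ 2 + ∑ i, ω i * (F i z * (1 - F i z)) := fun z => by
    simp only [hFω]
    rw [sum_mul_sub_sq_eq ω (fun i => F i z) hω_sum]
    ring
  simp_rw [hpointwise]
  rw [integral_add (integrable_finsetSum _ fun i _ => (hcramer i).const_mul (ω i))
      (integrable_finsetSum _ fun i _ => (hF_entropy i).const_mul (ω i)),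
    integral_finsetSum _ fun i _ => (hcramer i).const_mul (ω i),
    integral_finsetSum _ fun i _ => (hF_entropy i).const_mul (ω i)]
  simp_rw [integral_const_mul]
  ring
end

section
/- Let μ be a Borel probability measure on ℝ with finite first moment (∫ |x| dμ(x) < ∞), and let F(z) = μ((−∞, z]) denote its cumulative distribution function. Then the CRPS entropy admits the identity (1/2) ∫∫ |x − x̃| dμ(x) dμ(x̃) = ∫_{−∞}^{∞} F(z)(1 − F(z)) dz, where the double integral is with respect to two independent draws from μ. -/
open MeasureTheory

/-- The expected positive part of `y - x`, for `x` and `y` drawn independently from `μ` and `ν`,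
by integrating the measure of `[x, y)` over the plane. -/
theorem lintegral_prod_ofReal_sub (μ ν : Measure ℝ) [SFinite μ] [SFinite ν] :
    ∫⁻ p, ENNReal.ofReal (p.2 - p.1) ∂(μ.prod ν) =
      ∫⁻ z, μ (Set.Iic z) * ν (Set.Ioi z) := by
  have hS : MeasurableSet {q : (ℝ × ℝ) × ℝ | q.1.1 ≤ q.2 ∧ q.2 < q.1.2} :=
    (measurableSet_le measurable_fst.fst measurable_snd).inter
      (measurableSet_lt measurable_snd measurable_fst.snd)
  calc ∫⁻ p, ENNReal.ofReal (p.2 - p.1) ∂(μ.prod ν)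
      = ((μ.prod ν).prod volume) {q : (ℝ × ℝ) × ℝ | q.1.1 ≤ q.2 ∧ q.2 < q.1.2} := by
        rw [Measure.prod_apply hS]
        exact lintegral_congr fun p => Real.volume_Ico.symm
    _ = ∫⁻ z, μ (Set.Iic z) * ν (Set.Ioi z) := by
        rw [Measure.prod_apply_symm hS]
        exact lintegral_congr fun z => Measure.prod_prod (Set.Iic z) (Set.Ioi z)

/-- The expected absolute difference of two independent draws from `μ`. -/
theorem lintegral_lintegral_ofReal_abs_sub (μ : Measure ℝ) [SFinite μ] :
    ∫⁻ x, ∫⁻ y, ENNReal.ofReal |x - y| ∂μ ∂μ =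
      2 * ∫⁻ z, μ (Set.Iic z) * μ (Set.Ioi z) := by
  have habs : ∀ p : ℝ × ℝ, ENNReal.ofReal |p.1 - p.2| =
      ENNReal.ofReal (p.2 - p.1) + ENNReal.ofReal (p.swap.2 - p.swap.1) := by
    intro p
    rcases le_total p.1 p.2 with h | h
    · simp [abs_of_nonpos (sub_nonpos.2 h), ENNReal.ofReal_of_nonpos (sub_nonpos.2 h)]
    · simp [abs_of_nonneg (sub_nonneg.2 h), ENNReal.ofReal_of_nonpos (sub_nonpos.2 h)]
  calc ∫⁻ x, ∫⁻ y, ENNReal.ofReal |x - y| ∂μ ∂μ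
      = ∫⁻ p, ENNReal.ofReal |p.1 - p.2| ∂(μ.prod μ) :=
        (lintegral_prod (fun p : ℝ × ℝ => ENNReal.ofReal |p.1 - p.2|)
          (by fun_prop)).symm
    _ = 2 * ∫⁻ z, μ (Set.Iic z) * μ (Set.Ioi z) := by
        simp_rw [habs]
        rw [lintegral_add_left (by fun_prop),
          lintegral_prod_swap (μ := μ) (ν := μ) (fun p : ℝ × ℝ => ENNReal.ofReal (p.2 - p.1)),
          lintegral_prod_ofReal_sub, two_mul]

/-- For a Borel probability measure `μ` on ℝ with finite first moment
and CDF `F(z) = μ((-∞, z])`, half the expected absolute difference of two independent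
draws from `μ` equals `∫ F(z)(1 - F(z)) dz` (the CRPS entropy). -/
theorem crps_entropy_identity
    (μ : Measure ℝ) (hprob : IsProbabilityMeasure μ)
    (hmom : Integrable (fun x => |x|) μ)
    (F : ℝ → ℝ) (hF : ∀ z, F z = (μ (Set.Iic z)).toReal) :
    (1 / 2) * (∫ x, (∫ x', |x - x'| ∂μ) ∂μ) = ∫ z, F z * (1 - F z) := by
  have hid : Integrable (fun x : ℝ => x) μ :=
    (integrable_norm_iff (by fun_prop)).1 hmom
  have hinner : ∀ x, ∫⁻ y, ENNReal.ofReal |x - y| ∂μ < ⊤ := fun x =>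
    (((integrable_const x).sub hid).abs).lintegral_lt_top
  have hmeas : Measurable fun z => μ (Set.Iic z) * μ (Set.Ioi z) := by
    refine Measurable.mul ?_ ?_
    · exact Monotone.measurable fun a b h => measure_mono (Set.Iic_subset_Iic.2 h)
    · exact Antitone.measurable fun a b h => measure_mono (Set.Ioi_subset_Ioi h)
  have hright : ∀ z, F z * (1 - F z) = (μ (Set.Iic z) * μ (Set.Ioi z)).toReal := by
    intro z
    rw [hF, ENNReal.toReal_mul, ← Set.compl_Iic, prob_compl_eq_one_sub measurableSet_Iic,
      ENNReal.toReal_sub_of_le prob_le_one ENNReal.one_ne_top, ENNReal.toReal_one]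
  have hleft : ∀ x, ∫ y, |x - y| ∂μ = (∫⁻ y, ENNReal.ofReal |x - y| ∂μ).toReal := fun x =>
    integral_eq_lintegral_of_nonneg_ae (.of_forall fun y => abs_nonneg _) (by fun_prop)
  simp_rw [hleft, hright]
  rw [integral_toReal (Measurable.lintegral_prod_right' (f := fun p : ℝ × ℝ =>
      ENNReal.ofReal |p.1 - p.2|) (by fun_prop)).aemeasurable (.of_forall hinner),
    integral_toReal hmeas.aemeasurable (.of_forall fun z =>
      ENNReal.mul_lt_top (measure_lt_top _ _) (measure_lt_top _ _)),
    lintegral_lintegral_ofReal_abs_sub, ENNReal.toReal_mul, ENNReal.toReal_ofNat]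
  ring
end

section
/- Let Ω = {1, …, k} and let L(z, z̃) = |z̃ − z| (the Ranked Probability Score kernel). Let p¹, …, pⁿ be probability vectors on Ω with nonnegative weights ω_1, …, ω_n summing to one, and let p^ω = Σ_{i=1}^n ω_i pⁱ be the linear pool. Write P^i_l = Σ_{r=1}^l pⁱ(r) and P^ω_l = Σ_{r=1}^l p^ω(r) for the cumulative probabilities. Then the disagreement D = (1/2) Σ_{z,z̃∈Ω} p^ω(z) p^ω(z̃) |z̃ − z| − (1/2) Σ_{i=1}^n ω_i Σ_{z,z̃∈Ω} pⁱ(z) pⁱ(z̃) |z̃ − z| satisfies D = Σ_{i=1}^n ω_i Σ_{l=1}^k (P^i_l − P^ω_l)². -/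
open Finset

/-- The distance between two outcomes counts the thresholds separating them. -/
lemma abs_sub_eq_sum_indicator_sq {k : ℕ} (z z' : Fin k) :
    |((z' : ℕ) : ℝ) - ((z : ℕ) : ℝ)|
      = ∑ l, ((if z ≤ l then (1 : ℝ) else 0) - (if z' ≤ l then 1 else 0)) ^ 2 := by
  wlog h : z ≤ z' generalizing z z'
  · rw [abs_sub_comm, this z' z (le_of_not_ge h)]
    exact Finset.sum_congr rfl fun l _ => by ring
  have hterm : ∀ l : Fin k,
      ((if z ≤ l then (1 : ℝ) else 0) - (if z' ≤ l then 1 else 0)) ^ 2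
        = if l ∈ Finset.Ico z z' then 1 else 0 := by
    intro l
    by_cases h₁ : z ≤ l <;> by_cases h₂ : z' ≤ l
    · simp [h₁, h₂]
    · simp [h₁, h₂, not_le.mp h₂]
    · exact absurd (h.trans h₂) h₁
    · simp [h₁, h₂]
  have hcast : ((z : ℕ) : ℝ) ≤ ((z' : ℕ) : ℝ) := by exact_mod_cast h
  rw [Finset.sum_congr rfl fun l _ => hterm l, Finset.sum_ite_mem, Finset.univ_inter,
    Finset.sum_const, Fin.card_Ico, abs_of_nonneg (sub_nonneg.mpr hcast), nsmul_eq_mul, mul_one,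
    Nat.cast_sub h]

/-- The entropy of the Ranked Probability Score in terms of cumulative probabilities. -/
lemma half_sum_mul_abs_sub_eq_sum_cumulative {k : ℕ} (q : Fin k → ℝ) (hq : ∑ l, q l = 1) :
    (1 / 2) * (∑ z, ∑ z', q z * q z' * |((z' : ℕ) : ℝ) - ((z : ℕ) : ℝ)|)
      = ∑ l, (∑ r ∈ Finset.Iic l, q r) * (1 - ∑ r ∈ Finset.Iic l, q r) := by
  have hcum : ∀ l : Fin k,
      ∑ r ∈ Finset.Iic l, q r = ∑ r, q r * (if r ≤ l then (1 : ℝ) else 0) := by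
    intro l
    simp only [mul_ite, mul_one, mul_zero, ← Finset.sum_filter]
    exact Finset.sum_congr (by ext; simp) fun _ _ => rfl
  have hthreshold : ∀ l : Fin k,
      ∑ z, ∑ z', q z * q z' *
          ((if z ≤ l then (1 : ℝ) else 0) - (if z' ≤ l then 1 else 0)) ^ 2
        = 2 * ((∑ r ∈ Finset.Iic l, q r) * (1 - ∑ r ∈ Finset.Iic l, q r)) := by
    intro l
    rw [hcum l]
    set a : Fin k → ℝ := fun r => if r ≤ l then 1 else 0 with ha
    have hsq : ∀ r, a r ^ 2 = a r := fun r => by simp [ha]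
    calc ∑ z, ∑ z', q z * q z' * (a z - a z') ^ 2
        = ∑ z, ∑ z', ((q z * a z) * q z' + q z * (q z' * a z')
            - 2 * ((q z * a z) * (q z' * a z'))) := by
          refine Finset.sum_congr rfl fun z _ => Finset.sum_congr rfl fun z' _ => ?_
          linear_combination q z * q z' * (hsq z + hsq z')
      _ = 2 * ((∑ r, q r * a r) * (1 - ∑ r, q r * a r)) := by
          simp only [Finset.sum_sub_distrib, Finset.sum_add_distrib, ← Finset.mul_sum,
            ← Finset.sum_mul, hq]
          ring
  simp only [abs_sub_eq_sum_indicator_sq]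
  have hswap : ∑ z, ∑ z', q z * q z' *
        ∑ l, ((if z ≤ l then (1 : ℝ) else 0) - (if z' ≤ l then 1 else 0)) ^ 2
      = ∑ l, ∑ z, ∑ z', q z * q z' *
        ((if z ≤ l then (1 : ℝ) else 0) - (if z' ≤ l then 1 else 0)) ^ 2 := by
    simp only [Finset.mul_sum]
    conv_rhs => rw [Finset.sum_comm]
    exact Finset.sum_congr rfl fun z _ => Finset.sum_comm
  rw [hswap, Finset.sum_congr rfl fun l _ => hthreshold l, ← Finset.mul_sum]
  ring

/-- For the Ranked Probability Score kernel `L(z, z̃) = |z̃ - z|` on the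
finite ordered outcome space `{1, …, k}`, the disagreement of the linear pool equals
`∑ i, ω i * ∑ l, (Pⁱ_l - P^ω_l)²`, where `P_l` denotes cumulative probabilities. -/
theorem rps_disagreement
    {k n : ℕ}
    (p : Fin n → Fin k → ℝ)
    (hp_nonneg : ∀ i l, 0 ≤ p i l) (hp_sum : ∀ i, (∑ l, p i l) = 1)
    (ω : Fin n → ℝ) (hω_nonneg : ∀ i, 0 ≤ ω i) (hω_sum : (∑ i, ω i) = 1)
    (pω : Fin k → ℝ) (hpω : pω = fun l => ∑ i, ω i * p i l)
    (P : Fin n → Fin k → ℝ) (hP : ∀ i l, P i l = ∑ r ∈ Finset.Iic l, p i r)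
    (Pω : Fin k → ℝ) (hPω : ∀ l, Pω l = ∑ r ∈ Finset.Iic l, pω r)
    (D : ℝ)
    (hD : D = (1 / 2) * (∑ z, ∑ z', pω z * pω z' * |((z' : ℕ) : ℝ) - ((z : ℕ) : ℝ)|)
        - (1 / 2) * ∑ i, ω i *
            ∑ z, ∑ z', p i z * p i z' * |((z' : ℕ) : ℝ) - ((z : ℕ) : ℝ)|) :
    D = ∑ i, ω i * ∑ l, (P i l - Pω l) ^ 2 := by
  have hpω_sum : ∑ l, pω l = 1 := by
    simp only [hpω]
    rw [Finset.sum_comm]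
    simp only [← Finset.mul_sum, hp_sum, mul_one, hω_sum]
  have hpool : ∀ l, ∑ i, ω i * P i l = Pω l := by
    intro l
    simp only [hPω, hP, hpω, Finset.mul_sum]
    exact Finset.sum_comm
  have hvariance : ∀ l, ∑ i, ω i * (P i l - Pω l) ^ 2
      = Pω l * (1 - Pω l) - ∑ i, ω i * (P i l * (1 - P i l)) := by
    intro l
    calc ∑ i, ω i * (P i l - Pω l) ^ 2
        = ∑ i, (ω i * P i l - ω i * (P i l * (1 - P i l))
            - 2 * (ω i * P i l * Pω l) + ω i * Pω l ^ 2) :=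
          Finset.sum_congr rfl fun i _ => by ring
      _ = Pω l * (1 - Pω l) - ∑ i, ω i * (P i l * (1 - P i l)) := by
          simp only [Finset.sum_sub_distrib, Finset.sum_add_distrib, ← Finset.mul_sum,
            ← Finset.sum_mul, hpool, hω_sum]
          ring
  have hentropy : ∀ i,
      (1 / 2) * (∑ z, ∑ z', p i z * p i z' * |((z' : ℕ) : ℝ) - ((z : ℕ) : ℝ)|)
        = ∑ l, P i l * (1 - P i l) := by
    intro i
    simp only [hP, half_sum_mul_abs_sub_eq_sum_cumulative (p i) (hp_sum i)]
  have hexperts : (1 / 2) * ∑ i, ω i *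
        ∑ z, ∑ z', p i z * p i z' * |((z' : ℕ) : ℝ) - ((z : ℕ) : ℝ)|
      = ∑ l, ∑ i, ω i * (P i l * (1 - P i l)) := by
    rw [Finset.sum_comm, Finset.mul_sum]
    refine Finset.sum_congr rfl fun i _ => ?_
    rw [← Finset.mul_sum, ← hentropy i]
    ring
  rw [hD, half_sum_mul_abs_sub_eq_sum_cumulative pω hpω_sum, hexperts, ← Finset.sum_sub_distrib]
  simp only [← hPω, ← hvariance, Finset.mul_sum]
  exact Finset.sum_comm
end
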